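/- The alternating bit protocol is deadlock-free and converges to L: in every state at least one ABP action is enabled, and every maximal computation starting from an arbitrary state (arbitrary values of ns, nr, cd, ca) contains a state in L; moreover a state of L is reached within at most 4 steps. -/

import Mathlib

/-- A state of the alternating bit protocol: the sender's and receiver's
boolean sequence numbers `ns`, `nr`, the data channel `cd` (sender to
receiver) and the ack channel `ca` (receiver to sender), each of capacity
one. -/
structure ABPState where
  ns : Bool
  nr : Bool
  cd : Option Bool
  ca : Option Bool
deriving DecidableEq

/-- Sending message `m` on a channel of capacity one: if the channel is empty
the message is placed in it, otherwise the new message is lost. -/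
def send (c : Option Bool) (m : Bool) : Option Bool :=
  match c with
  | none => some m
  | some x => some x

/-- One step of the alternating bit protocol: `t` is obtained from `s` by
executing one enabled action (`next`, `timeout` or `reply`). -/
def abpStep (s t : ABPState) : Prop :=
  -- next: receive ack(a); if a = ns then flip ns and send data(ns)
  (∃ a, s.ca = some a ∧
    t = if a = s.ns then
          ⟨!s.ns, s.nr, send s.cd (!s.ns), none⟩
        else
          ⟨s.ns, s.nr, s.cd, none⟩) ∨
  -- timeout: both channels empty; resend data(ns)
  (s.cd = none ∧ s.ca = none ∧ t = ⟨s.ns, s.nr, some s.ns, none⟩) ∨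
  -- reply: receive data(b); if b ≠ nr then nr := b; send ack(b)
  (∃ b, s.cd = some b ∧
    t = ⟨s.ns, if b = s.nr then s.nr else b, none, send s.ca b⟩)

/-- The legitimate set `L` of the alternating bit protocol. -/
def Legit (s : ABPState) : Prop :=
  (s.cd = some s.ns ∧ s.ca = none) ∨
  (s.cd = none ∧ s.ca = some s.ns ∧ s.nr = s.ns)

/-- Both channels empty: the next state is legitimate. -/
theorem step_empty {s t : ABPState} (h : abpStep s t) (hd : s.cd = none) (ha : s.ca = none) :
    Legit t := by
  rcases h with ⟨a, h, _⟩ | ⟨_, _, rfl⟩ | ⟨b, h, _⟩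
  · simp [ha] at h
  · simp [Legit]
  · simp [hd] at h

/-- Only an ack in transit: the next state is legitimate or has empty channels. -/
theorem step_ack {s t : ABPState} (h : abpStep s t) (hd : s.cd = none) (ha : s.ca ≠ none) :
    Legit t ∨ (t.cd = none ∧ t.ca = none) := by
  rcases h with ⟨a, h, rfl⟩ | ⟨_, h, _⟩ | ⟨b, h, _⟩
  · by_cases e : a = s.ns <;> simp [e, Legit, hd, send]
  · exact absurd h ha
  · simp [hd] at h

/-- Only data in transit: the next state has only an ack in transit. -/
theorem step_data {s t : ABPState} (h : abpStep s t) (hd : s.cd ≠ none) (ha : s.ca = none) :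
    t.cd = none ∧ t.ca ≠ none := by
  rcases h with ⟨a, h, _⟩ | ⟨h, _, _⟩ | ⟨b, h, rfl⟩
  · simp [ha] at h
  · exact absurd h hd
  · simp [ha, send]

/-- Both channels full: the next state has exactly one message in transit. -/
theorem step_full {s t : ABPState} (h : abpStep s t) (hd : s.cd ≠ none) (ha : s.ca ≠ none) :
    (t.cd ≠ none ∧ t.ca = none) ∨ (t.cd = none ∧ t.ca ≠ none) := by
  rcases h with ⟨a, h, rfl⟩ | ⟨h, _, _⟩ | ⟨b, h, rfl⟩
  · left
    obtain ⟨d, hd'⟩ := Option.ne_none_iff_exists'.mp hd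
    by_cases e : a = s.ns <;> simp [e, hd', send]
  · exact absurd h hd
  · right
    obtain ⟨d, ha'⟩ := Option.ne_none_iff_exists'.mp ha
    simp [ha', send]

/-- The alternating bit protocol is deadlock-free (so every maximal computation
is infinite) and converges to the legitimate set `L` from an arbitrary state:
every computation contains a state of `L`, reached within at most 4 steps. -/
theorem abp_converges :
    (∀ s : ABPState, ∃ t, abpStep s t) ∧
    (∀ c : ℕ → ABPState, (∀ n, abpStep (c n) (c (n + 1))) →
      ∃ n, n ≤ 4 ∧ Legit (c n)) := by
  constructor
  · intro s
    rcases ha : s.ca with _ | a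
    · rcases hd : s.cd with _ | b
      · exact ⟨_, Or.inr (Or.inl ⟨hd, ha, rfl⟩)⟩
      · exact ⟨_, Or.inr (Or.inr ⟨b, hd, rfl⟩)⟩
    · exact ⟨_, Or.inl ⟨a, ha, rfl⟩⟩
  · intro c hc
    have h1 : ∀ n, (c n).cd = none → (c n).ca = none → ∃ m, m ≤ n + 1 ∧ Legit (c m) :=
      fun n hd ha => ⟨n + 1, le_rfl, step_empty (hc n) hd ha⟩
    have h2 : ∀ n, (c n).cd = none → (c n).ca ≠ none → ∃ m, m ≤ n + 2 ∧ Legit (c m) := by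
      intro n hd ha
      rcases step_ack (hc n) hd ha with h | ⟨h, h'⟩
      · exact ⟨n + 1, by omega, h⟩
      · exact h1 (n + 1) h h'
    have h3 : ∀ n, (c n).cd ≠ none → (c n).ca = none → ∃ m, m ≤ n + 3 ∧ Legit (c m) := by
      intro n hd ha
      obtain ⟨h, h'⟩ := step_data (hc n) hd ha
      exact h2 (n + 1) h h'
    have weaken : ∀ k, k ≤ 4 → (∃ m, m ≤ k ∧ Legit (c m)) → ∃ m, m ≤ 4 ∧ Legit (c m) :=
      fun k hk ⟨m, hm, h⟩ => ⟨m, hm.trans hk, h⟩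
    by_cases hd : (c 0).cd = none <;> by_cases ha : (c 0).ca = none
    · exact weaken _ (by norm_num) (h1 0 hd ha)
    · exact weaken _ (by norm_num) (h2 0 hd ha)
    · exact weaken _ (by norm_num) (h3 0 hd ha)
    · rcases step_full (hc 0) hd ha with ⟨h, h'⟩ | ⟨h, h'⟩
      · exact weaken _ (by norm_num) (h3 1 h h')
      · exact weaken _ (by norm_num) (h2 1 h h')
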